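/- Fix σ > 0, λ₀ > 0, μ₀, μ₁ ∈ ℝ, and let (x̄ₙ)ₙ be a sequence of real numbers with x̄ₙ → m for some m ≠ μ₁. Define Sₙ = 1 − Φ( (1/σ² + 1/(nλ₀²σ²))^{1/2} · √n|x̄ₙ − μ₁| + √n x̄ₙ/(nλ₀² + 1) − √n μ₀/(nλ₀² + 1) ) + Φ( (1/σ² + 1/(nλ₀²σ²))^{1/2} · (−√n|x̄ₙ − μ₁|) + √n x̄ₙ/(nλ₀² + 1) − √n μ₀/(nλ₀² + 1) ). Then Sₙ → 0 as n → ∞. (The strength of the evidence for H₀: μ = μ₁ converges to 0 when the sample means converge to a value different from μ₁.) -/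

import Mathlib

open MeasureTheory ProbabilityTheory Filter Topology

/-- The standard normal cumulative distribution function `Φ`. -/
noncomputable def stdNormalCDF (z : ℝ) : ℝ := (gaussianReal 0 1 (Set.Iic z)).toReal

/-- The strength `Sₙ` of the evidence in the one-sample z-test with prior `N(μ₀, λ₀²σ²)` and
sample mean `x̄ₙ` of `n` observations, in closed form.  (`lam0` plays the role of `λ₀`.) -/
noncomputable def strengthZ (σ lam0 μ₀ μ₁ : ℝ) (xbar : ℕ → ℝ) (n : ℕ) : ℝ :=
  1 - stdNormalCDF ((1 / σ ^ 2 + 1 / ((n : ℝ) * lam0 ^ 2 * σ ^ 2)) ^ ((1 : ℝ) / 2) *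
        (Real.sqrt n * |xbar n - μ₁|) +
      Real.sqrt n * xbar n / ((n : ℝ) * lam0 ^ 2 + 1) -
      Real.sqrt n * μ₀ / ((n : ℝ) * lam0 ^ 2 + 1)) +
    stdNormalCDF ((1 / σ ^ 2 + 1 / ((n : ℝ) * lam0 ^ 2 * σ ^ 2)) ^ ((1 : ℝ) / 2) *
        (-(Real.sqrt n * |xbar n - μ₁|)) +
      Real.sqrt n * xbar n / ((n : ℝ) * lam0 ^ 2 + 1) -
      Real.sqrt n * μ₀ / ((n : ℝ) * lam0 ^ 2 + 1))

theorem stdNormalCDF_eq_cdf : stdNormalCDF = cdf (gaussianReal 0 1) := by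
  funext z
  rw [cdf_eq_real]
  rfl

theorem tendsto_stdNormalCDF_atTop : Tendsto stdNormalCDF atTop (𝓝 1) := by
  rw [stdNormalCDF_eq_cdf]
  exact tendsto_cdf_atTop _

theorem tendsto_stdNormalCDF_atBot : Tendsto stdNormalCDF atBot (𝓝 0) := by
  rw [stdNormalCDF_eq_cdf]
  exact tendsto_cdf_atBot _

theorem tendsto_sqrt_natCast_atTop : Tendsto (fun n : ℕ => Real.sqrt n) atTop atTop :=
  Real.tendsto_sqrt_atTop.comp tendsto_natCast_atTop_atTop

theorem tendsto_sqrt_natCast_div_mul_add_one {a : ℝ} (ha : 0 < a) :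
    Tendsto (fun n : ℕ => Real.sqrt n / ((n : ℝ) * a + 1)) atTop (𝓝 0) := by
  refine squeeze_zero' (g := fun n : ℕ => (Real.sqrt n * a)⁻¹)
    (Eventually.of_forall fun n => by positivity) ?_
    (tendsto_sqrt_natCast_atTop.atTop_mul_const ha).inv_tendsto_atTop
  filter_upwards [eventually_gt_atTop 0] with n hn
  have hs : 0 < Real.sqrt n := Real.sqrt_pos.2 (by exact_mod_cast hn)
  have hsq : Real.sqrt n * Real.sqrt n = n := Real.mul_self_sqrt n.cast_nonneg
  rw [inv_eq_one_div, div_le_div_iff₀ (by positivity) (by positivity)]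
  nlinarith

theorem tendsto_rpow_half_one_div_sq_add {σ a : ℝ} (hσ : 0 < σ) (ha : 0 < a) :
    Tendsto (fun n : ℕ => (1 / σ ^ 2 + 1 / ((n : ℝ) * a * σ ^ 2)) ^ ((1 : ℝ) / 2)) atTop
      (𝓝 ((1 / σ ^ 2) ^ ((1 : ℝ) / 2))) := by
  refine Tendsto.rpow_const ?_ (Or.inr (by norm_num))
  have h : Tendsto (fun n : ℕ => 1 / ((n : ℝ) * a * σ ^ 2)) atTop (𝓝 0) :=
    Tendsto.const_div_atTop
      ((tendsto_natCast_atTop_atTop.atTop_mul_const ha).atTop_mul_const (by positivity)) 1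
  simpa only [add_zero] using h.const_add (1 / σ ^ 2)

/-- If the sample means `x̄ₙ` converge to some `m ≠ μ₁`, then the strength `Sₙ` of the evidence
for `H₀ : μ = μ₁` converges to `0`. -/
theorem strength_tendsto_zero_of_false (σ lam0 μ₀ μ₁ m : ℝ) (hσ : 0 < σ) (hlam : 0 < lam0)
    (xbar : ℕ → ℝ) (hx : Tendsto xbar atTop (𝓝 m)) (hm : m ≠ μ₁) :
    Tendsto (fun n : ℕ => strengthZ σ lam0 μ₀ μ₁ xbar n) atTop (𝓝 0) := by
  have ha : 0 < lam0 ^ 2 := by positivity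
  have hd : 0 < |m - μ₁| := abs_pos.2 (sub_ne_zero.2 hm)
  have hc : 0 < (1 / σ ^ 2) ^ ((1 : ℝ) / 2) := by positivity
  have hmain := (tendsto_rpow_half_one_div_sq_add hσ ha).pos_mul_atTop hc
    (tendsto_sqrt_natCast_atTop.atTop_mul_pos hd (hx.sub_const μ₁).abs)
  have hrem := ((tendsto_sqrt_natCast_div_mul_add_one ha).mul hx).sub
    ((tendsto_sqrt_natCast_div_mul_add_one ha).mul_const μ₀)
  have htop := tendsto_stdNormalCDF_atTop.comp (hmain.atTop_add hrem)
  have hbot := tendsto_stdNormalCDF_atBot.comp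
    ((tendsto_neg_atTop_atBot.comp hmain).atBot_add hrem)
  have h := (htop.const_sub 1).add hbot
  rw [sub_self, add_zero] at h
  refine h.congr fun n => ?_
  simp only [strengthZ, Function.comp_apply, mul_neg, add_sub_assoc, div_mul_eq_mul_div]
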